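/- Let R be a ring and n ≥ 2 an integer. The quotient ring R[x]/⟨xⁿ⟩ of the polynomial ring R[x] by the two-sided ideal generated by xⁿ is a UWNC ring if and only if R is a UWNC ring. -/

import Mathlib

/-- An element of a ring is *weakly nil-clean* if it is `e + n` or `-e + n`
for an idempotent `e` and a nilpotent `n`. -/
def IsWeaklyNilClean {R : Type*} [Ring R] (a : R) : Prop :=
  ∃ e n : R, IsIdempotentElem e ∧ IsNilpotent n ∧ (a = e + n ∨ a = -e + n)

/-- An element of a ring is *nil-clean* if it is `e + n`
for an idempotent `e` and a nilpotent `n`. -/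
def IsNilClean {R : Type*} [Ring R] (a : R) : Prop :=
  ∃ e n : R, IsIdempotentElem e ∧ IsNilpotent n ∧ a = e + n

/-- A ring is *UWNC* if every unit is weakly nil-clean. -/
def IsUWNC (R : Type*) [Ring R] : Prop :=
  ∀ u : Rˣ, IsWeaklyNilClean (u : R)

/-- A ring is *UNC* if every unit is nil-clean. -/
def IsUNC (R : Type*) [Ring R] : Prop :=
  ∀ u : Rˣ, IsNilClean (u : R)

/-- A ring is *WUU* if every unit is of the form `n + 1` or `n - 1`
for a nilpotent `n`. -/
def IsWUU (R : Type*) [Ring R] : Prop :=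
  ∀ u : Rˣ, ∃ n : R, IsNilpotent n ∧ ((u : R) = n + 1 ∨ (u : R) = n - 1)

theorem IsWeaklyNilClean.map {R S : Type*} [Ring R] [Ring S] (f : R →+* S) {a : R}
    (h : IsWeaklyNilClean a) : IsWeaklyNilClean (f a) := by
  obtain ⟨e, m, he, hm, h⟩ := h
  refine ⟨f e, f m, he.map f, hm.map f, ?_⟩
  rcases h with rfl | rfl <;> simp

/-- Nilpotence can be tested modulo a nil kernel. -/
theorem isNilpotent_of_isNilpotent_map {R S : Type*} [Ring R] [Ring S] (f : R →+* S)
    (hf : ∀ a, f a = 0 → IsNilpotent a) {a : R} (h : IsNilpotent (f a)) : IsNilpotent a := by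
  obtain ⟨k, hk⟩ := h
  exact IsNilpotent.of_pow (hf (a ^ k) (by rw [map_pow, hk]))

/-- A split surjection with nil kernel preserves and reflects the UWNC property. -/
theorem isUWNC_iff_of_leftInverse {R S : Type*} [Ring R] [Ring S] (f : S →+* R) (g : R →+* S)
    (hfg : Function.LeftInverse f g) (hf : ∀ a, f a = 0 → IsNilpotent a) :
    IsUWNC S ↔ IsUWNC R := by
  constructor
  · intro h u
    simpa [hfg (u : R)] using (h (Units.map (g : R →* S) u)).map f
  · intro h u
    obtain ⟨e, m, he, hm, h⟩ := h (Units.map (f : S →* R) u)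
    simp only [Units.coe_map, MonoidHom.coe_coe] at h
    rcases h with h | h
    · refine ⟨g e, u - g e, he.map g, isNilpotent_of_isNilpotent_map f hf ?_, .inl (by abel)⟩
      simpa [hfg e, h] using hm
    · refine ⟨g e, u + g e, he.map g, isNilpotent_of_isNilpotent_map f hf ?_, .inr (by abel)⟩
      simpa [hfg e, h] using hm

theorem polynomial_quot_pow_isUWNC_iff {R : Type*} [Ring R] (n : ℕ) (hn : 2 ≤ n) :
    IsUWNC ((TwoSidedIdeal.span {(Polynomial.X : Polynomial R) ^ n}).ringCon.Quotient) ↔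
      IsUWNC R := by
  let I := TwoSidedIdeal.span {(Polynomial.X : Polynomial R) ^ n}
  have hn0 : n ≠ 0 := by omega
  have hI : I ≤ TwoSidedIdeal.ker (Polynomial.constantCoeff : Polynomial R →+* R) := by
    rw [TwoSidedIdeal.span_le]
    simp [TwoSidedIdeal.mem_ker, hn0.symm]
  let f : I.ringCon.Quotient →+* R := I.ringCon.lift Polynomial.constantCoeff
    fun _ _ h => (TwoSidedIdeal.ker_ringCon _).1 (TwoSidedIdeal.ringCon_le_iff.1 hI h)
  refine isUWNC_iff_of_leftInverse f (I.ringCon.mk'.comp Polynomial.C) (fun r => ?_) ?_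
  · change Polynomial.constantCoeff (Polynomial.C r) = r
    simp
  · intro a
    obtain ⟨p, rfl⟩ := I.ringCon.mk'_surjective a
    intro hp
    change Polynomial.constantCoeff p = 0 at hp
    obtain ⟨q, rfl⟩ := Polynomial.X_dvd_iff.2 hp
    refine ⟨n, ?_⟩
    rw [← map_pow, (Polynomial.commute_X q).mul_pow, map_mul]
    have hX : I.ringCon.mk' ((Polynomial.X : Polynomial R) ^ n) = 0 :=
      (RingCon.eq _).2 (TwoSidedIdeal.subset_span rfl)
    rw [hX, zero_mul]
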